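/- Let Y, Y' be Polish spaces, A a Borel subset of Y×Y', and (X,(f_n)) a converging situation such that A ≤ʳ_c A^f. Then exactly one of the following holds: (a) A is pot(Π⁰₁); (b) there exist a Borel subset B of X and a finer topology τ on B such that ([B,τ],(f^B_n)_n) is a converging situation and A^f ∩ B² ≤ʳ_c A. -/

import Mathlib

open Set Topology

abbrev Cantor : Type := ℕ → Bool

/-- `A ⊆ X × Y` is potentially closed (`pot(Π⁰₁)`): there are finer Polish topologies on `X`
and `Y` making `A` closed in the product. -/
def PotClosed {X Y : Type} (tX : TopologicalSpace X) (tY : TopologicalSpace Y)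
    (A : Set (X × Y)) : Prop :=
  ∃ (σ : TopologicalSpace X) (τ : TopologicalSpace Y),
    σ ≤ tX ∧ τ ≤ tY ∧ @PolishSpace X σ ∧ @PolishSpace Y τ ∧
    @IsClosed (X × Y) (@instTopologicalSpaceProd X Y σ τ) A

/-- Membership in the class `D₂(Σ⁰₁)`: difference of two open sets. -/
def D2Sigma01 {Z : Type} (t : TopologicalSpace Z) (A : Set Z) : Prop :=
  ∃ U V : Set Z, @IsOpen Z t U ∧ @IsOpen Z t V ∧ A = U \ V

/-- The rectangular continuous reducibility `A ≤ʳ_c A'`. -/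
def RedRC {X Y X' Y' : Type} (tX : TopologicalSpace X) (tY : TopologicalSpace Y)
    (tX' : TopologicalSpace X') (tY' : TopologicalSpace Y')
    (A : Set (X × Y)) (A' : Set (X' × Y')) : Prop :=
  ∃ (u : X → X') (v : Y → Y'),
    @Continuous X X' tX tX' u ∧ @Continuous Y Y' tY tY' v ∧
    A = (fun p => (u p.1, v p.2)) ⁻¹' A'

/-- `≤ʳ_c` on subsets of `Cantor × Cantor` with the standard topology. -/
def RedC2 (A A' : Set (Cantor × Cantor)) : Prop :=
  RedRC inferInstance inferInstance inferInstance inferInstance A A'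

/-- `A` is `≤ʳ_c`-minimal among non-potentially closed Borel sets. -/
def MinNonPotClosed {X Y : Type} (tX : TopologicalSpace X) (tY : TopologicalSpace Y)
    (A : Set (X × Y)) : Prop :=
  ¬ PotClosed tX tY A ∧
  ∀ (X' Y' : Type) (tX' : TopologicalSpace X') (tY' : TopologicalSpace Y'),
    @PolishSpace X' tX' → @PolishSpace Y' tY' →
    ∀ A' : Set (X' × Y'),
      @MeasurableSet (X' × Y') (@borel (X' × Y') (@instTopologicalSpaceProd X' Y' tX' tY')) A' →
      ¬ PotClosed tX' tY' A' →
      RedRC tX' tY' tX tY A' A → RedRC tX tY tX' tY' A A'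

/-- The Borel reducibility `A ≤_B A'` for square sets. -/
def RedB {Z Z' : Type} (tZ : TopologicalSpace Z) (tZ' : TopologicalSpace Z')
    (A : Set (Z × Z)) (A' : Set (Z' × Z'))  : Prop :=
  ∃ u : Z → Z', @Measurable Z Z' (@borel Z tZ) (@borel Z' tZ') u ∧
    A = (fun p => (u p.1, u p.2)) ⁻¹' A'

/-- `A` is `≤_B`-minimal among non-potentially closed Borel (square) sets. -/
def MinBNonPotClosed {Z : Type} (tZ : TopologicalSpace Z) (A : Set (Z × Z)) : Prop :=
  ¬ PotClosed tZ tZ A ∧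
  ∀ (Z' : Type) (tZ' : TopologicalSpace Z'), @PolishSpace Z' tZ' →
    ∀ A' : Set (Z' × Z'),
      @MeasurableSet (Z' × Z') (@borel (Z' × Z') (@instTopologicalSpaceProd Z' Z' tZ' tZ')) A' →
      ¬ PotClosed tZ' tZ' A' →
      RedB tZ' tZ A' A → RedB tZ tZ' A A'

/-- The graph of the partial function `f` with domain `D`. -/
def graphRel {X : Type} (D : Set X) (f : X → X) : Set (X × X) :=
  {p | p.1 ∈ D ∧ p.2 = f p.1}

/-- `A^f := ⋃ₙ Graph(fₙ)`. -/
def unionGraphs {X : Type} (D : ℕ → Set X) (f : ℕ → X → X) : Set (X × X) :=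
  ⋃ n, graphRel (D n) (f n)

/-- `f` restricted to `D` is a partial homeomorphism with clopen domain and clopen range. -/
def IsPartialHomeo {X : Type} (t : TopologicalSpace X) (D : Set X) (f : X → X) : Prop :=
  @IsClopen X t D ∧ @IsClopen X t (f '' D) ∧ @ContinuousOn X X t t f D ∧
    ∃ g : X → X, @ContinuousOn X X t t g (f '' D) ∧ ∀ x ∈ D, g (f x) = x

/-- A converging situation: a nonempty zero-dimensional perfect Polish space together with
partial homeomorphisms with clopen domains and ranges such that
`Δ(X) = closure(A^f) \ A^f`. -/
def ConvSit (X : Type) (t : TopologicalSpace X) (D : ℕ → Set X) (f : ℕ → X → X) : Prop :=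
  Nonempty X ∧ @PolishSpace X t ∧
  @TopologicalSpace.IsTopologicalBasis X t {s : Set X | @IsClopen X t s} ∧
  @Perfect X t Set.univ ∧
  (∀ n, IsPartialHomeo t (D n) (f n)) ∧
  Set.diagonal X =
    @closure (X × X) (@instTopologicalSpaceProd X X t t) (unionGraphs D f) \ unionGraphs D f

/-- The domain of the restriction `f^B` of the partial map `(D, f)` to a subset `B`. -/
def subD {X : Type} (B : Set X) (D : Set X) (f : X → X) : Set ↥B :=
  {x | (x : X) ∈ D ∧ f (x : X) ∈ B}

/-- The restriction `f^B` of `f` to `B`, as a map of the subtype (junk value outside). -/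
noncomputable def subF {X : Type} (B : Set X) (f : X → X) : ↥B → ↥B :=
  fun x =>
    letI := Classical.dec (f (x : X) ∈ B)
    if h : f (x : X) ∈ B then ⟨f (x : X), h⟩ else x

/-- `A^f ∩ B²`, viewed on the subtype `B`: the union of the graphs of the `f^B_n`'s. -/
def restrGraphs {X : Type} (B : Set X) (D : ℕ → Set X) (f : ℕ → X → X) : Set (↥B × ↥B) :=
  unionGraphs (fun n => subD B (D n) (f n)) (fun n => subF B (f n))

/-- The subspace topology on `B` induced by a topology `t` on `X`. -/
def subTop {X : Type} (t : TopologicalSpace X) (B : Set X) : TopologicalSpace ↥B :=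
  @TopologicalSpace.induced ↥B X Subtype.val t

/-- The natural bijection `ψ : ω → 2^{<ω}` (enumeration by length, then lexicographically):
`ψ(n)` is the binary expansion of `n+1` with its leading one removed. -/
def psiSeq (n : ℕ) : List Bool := ((n + 1).bits.dropLast).reverse

/-- `s_n := ψ(n)0^{n-|ψ(n)|}`, a dense sequence with `|s_n| = n`. -/
def sSeq (n : ℕ) : List Bool := psiSeq n ++ List.replicate (n - (psiSeq n).length) false

/-- The concatenation `sγ` of a finite sequence `s` with `γ ∈ 2^ω`. -/
def catSeq (s : List Bool) (γ : Cantor) : Cantor :=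
  fun i => if h : i < s.length then s.get ⟨i, h⟩ else γ (i - s.length)

/-- `A₁ := {(s_n0γ, s_n1γ) : n ∈ ω, γ ∈ 2^ω}`. -/
def A1 : Set (Cantor × Cantor) :=
  {p | ∃ (n : ℕ) (γ : Cantor),
    p.1 = catSeq (sSeq n ++ [false]) γ ∧ p.2 = catSeq (sSeq n ++ [true]) γ}

/-- `Card(x↾n)`: the number of ones among the first `n` coordinates of `x`. -/
def cardOnes (x : Cantor) (n : ℕ) : ℕ := ∑ i ∈ Finset.range n, (if x i then 1 else 0)

/-- The domain of `f^S_n`: sequences vanishing at `n` whose first `n` coordinates contain a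
number of ones belonging to `S`. -/
def DSdom (S : Set ℕ) (n : ℕ) : Set Cantor := {x | x n = false ∧ cardOnes x n ∈ S}

/-- `f^S_n (s0γ) := s1γ`: flip the `n`-th coordinate to one. -/
def fSfun (n : ℕ) : Cantor → Cantor := fun x => Function.update x n true

/-- `A^S := {(s0γ, s1γ) : s ∈ 2^{<ω}, Card(s) ∈ S, γ ∈ 2^ω} = ⋃ₙ Graph(f^S_n)`. -/
def ASet (S : Set ℕ) : Set (Cantor × Cantor) := unionGraphs (DSdom S) fSfun

/-- Condition (M) on `S ⊆ ω`. -/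
def CondM (S : Set ℕ) : Prop :=
  ∀ p : ℕ, ∃ k : ℕ, ∀ q : ℕ, ∃ c : ℕ, q ≤ c ∧ c ≤ q + k ∧
    (fun m => c + m) '' (S ∩ Set.Iic p) = S ∩ Set.Icc c (c + p)

/-- Condition (H) on `S ⊆ ω`. -/
def CondH (S : Set ℕ) : Prop :=
  ∀ C : Set Cantor, @MeasurableSet Cantor (borel Cantor) C →
    ∀ σ : TopologicalSpace ↥C, σ ≤ subTop inferInstance C →
      ConvSit ↥C σ (fun n => subD C (DSdom S n) (fSfun n)) (fun n => subF C (fSfun n)) →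
      ∀ l p : ℕ, ∃ n : ℕ, l ≤ n ∧ ∃ γ : ↥C, γ ∈ subD C (DSdom S n) (fSfun n) ∧
        (fun m => cardOnes (γ : Cantor) n + m) '' (S ∩ Set.Iic p) =
          S ∩ Set.Icc (cardOnes (γ : Cantor) n) (cardOnes (γ : Cantor) n + p)

/-- Condition (⊥) on a pair `(S, S')`. -/
def CondPerp (S S' : Set ℕ) : Prop :=
  ∃ p : ℕ, ∀ c : ℕ, (fun m => c + m) '' (S ∩ Set.Iic p) ≠ S' ∩ Set.Icc c (c + p)

/-- Condition (⊥⁻¹) on a pair `(S, S')` (stated in `ℤ` to handle subtraction). -/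
def CondPerpInv (S S' : Set ℕ) : Prop :=
  ∃ p : ℕ, ∀ c : ℕ,
    (fun m : ℕ => (c : ℤ) - (m : ℤ)) '' (S ∩ Set.Iic p) ≠
      ((fun n : ℕ => (n : ℤ)) '' S') ∩ Set.Icc ((c : ℤ) - (p : ℤ)) (c : ℤ)

/-- `A⁻¹ := {(y,x) : (x,y) ∈ A}`. -/
def invRel {X : Type} (A : Set (X × X)) : Set (X × X) := {p | (p.2, p.1) ∈ A}

/-- `γ_α`: `γ_α(4n+2ε) = ε` and `γ_α(2n+1) = α(n)`. -/
def gammaSeq (α : Cantor) (k : ℕ) : Bool :=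
  if k % 2 = 1 then α (k / 2) else decide (k % 4 = 2)

/-- `β_α(i) := γ_α((i)₀)` where `(i)₀ = max {m : 2^m ∣ i+1}`, with values in `{0,1} ⊆ ω`. -/
def betaSeq (α : Cantor) (i : ℕ) : ℕ :=
  if gammaSeq α ((i + 1).factorization 2) then 1 else 0

/-- `S_β := {Σ_{i<l} (1 + β(i)) : l ∈ ω}`. -/
def Sbeta (β : ℕ → ℕ) : Set ℕ :=
  {m | ∃ l : ℕ, m = ∑ i ∈ Finset.range l, (1 + β i)}

/-- `s_n` as a function `ℕ → Bool` (with junk value `false` beyond `n`). -/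
def sSeqFn (n : ℕ) (i : ℕ) : Bool := (sSeq n).getD i false

/-- The domain of `f¹_n` (direction `d = true`) or of `(f¹_n)⁻¹` (direction `d = false`):
`x` extends `s_n` and `x(n) = !d`. -/
def step1Dom (n : ℕ) (d : Bool) : Set Cantor :=
  {x | (∀ i, i < n → x i = sSeqFn n i) ∧ x n = !d}

/-- `f¹_n` (if `d = true`) or its inverse (if `d = false`): set the `n`-th coordinate to `d`. -/
def step1Fun (n : ℕ) (d : Bool) : Cantor → Cantor := fun x => Function.update x n d

/-- Domain of `fₙ` (direction `d = true`) or of `fₙ⁻¹` (direction `d = false`). -/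
def stepDom {X : Type} (D : ℕ → Set X) (f : ℕ → X → X) (n : ℕ) (d : Bool) : Set X :=
  if d then D n else f n '' D n

/-- `fₙ` (direction `d = true`) or its inverse `gₙ` (direction `d = false`). -/
def stepFun {X : Type} (f g : ℕ → X → X) (n : ℕ) (d : Bool) : X → X :=
  if d then f n else g n

/-- An acyclic situation (Definition 26), with `g n` the inverse of `f n`. -/
def AcyclicSit (X : Type) (t : TopologicalSpace X) (D : ℕ → Set X) (f g : ℕ → X → X) : Prop :=
  Nonempty X ∧ @PolishSpace X t ∧
  @TopologicalSpace.IsTopologicalBasis X t {s : Set X | @IsClopen X t s} ∧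
  @Perfect X t Set.univ ∧
  (∀ n, IsPartialHomeo t (D n) (f n)) ∧
  (∀ n, ∀ x ∈ D n, g n (f n x) = x) ∧
  Set.diagonal X ⊆
    @closure (X × X) (@instTopologicalSpaceProd X X t t) (unionGraphs D f) \ unionGraphs D f ∧
  (∀ m : ℕ, 1 ≤ m → ∀ (v : ℕ → ℕ) (ε : ℕ → Bool),
    (∀ i, i + 1 < m → v i ≠ v (i + 1) ∨ ε i = ε (i + 1)) →
    ∀ U : Set X, @IsClopen X t U → U.Nonempty →
      ∃ V : Set X, @IsClopen X t V ∧ V.Nonempty ∧ V ⊆ U ∧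
        ∀ x ∈ V, ∀ w : ℕ → X, w 0 = x →
          (∀ i, i < m → w i ∈ stepDom D f (v i) (ε i) ∧
            w (i + 1) = stepFun f g (v i) (ε i) (w i)) →
          w m ∉ V)

/-- The relation `ℜ_Θ` on `2^{<ω}`: `e ℜ_Θ e'` iff `e = e'` or
`(e, e') = (θ_n0w, θ_n1w)` for some `n` and `w`. -/
def RTheta (θ : ℕ → List Bool) (e e' : List Bool) : Prop :=
  e = e' ∨ ∃ (n : ℕ) (w : List Bool), e = θ n ++ false :: w ∧ e' = θ n ++ true :: w

/-- The symmetrization `s(ℜ_Θ)`. -/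
def sRTheta (θ : ℕ → List Bool) (e e' : List Bool) : Prop :=
  RTheta θ e e' ∨ RTheta θ e' e

section

open MeasureTheory

/-- `C` contains no edge of `⋃ₙ Graph(fₙ)`. -/
def IndepSet {X : Type} (D : ℕ → Set X) (f : ℕ → X → X) (C : Set X) : Prop :=
  ∀ n, ∀ x ∈ C, x ∈ D n → f n x ∉ C

theorem IndepSet.mono {X : Type} {D : ℕ → Set X} {f : ℕ → X → X} {C C' : Set X}
    (h : IndepSet D f C) (hC : C' ⊆ C) : IndepSet D f C' :=
  fun n x hx hxD hfx => h n x (hC hx) hxD (hC hfx)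

theorem exists_isOpen_isMeagre_diff {Z : Type} [TopologicalSpace Z] [MeasurableSpace Z]
    [BorelSpace Z] {M : Set Z} (hM : MeasurableSet M) (hne : ¬ IsMeagre M) :
    ∃ U : Set Z, IsOpen U ∧ U.Nonempty ∧ IsMeagre (U \ M) := by
  obtain ⟨U, hU, h⟩ := hM.residualEq_isOpen
  refine ⟨U, hU, ?_, ?_⟩
  · rw [nonempty_iff_ne_empty]
    rintro rfl
    apply hne
    rw [IsMeagre]
    filter_upwards [h] with x hx hxM
    have : (x ∈ M) = (x ∈ (∅ : Set Z)) := hx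
    simp_all
  · rw [IsMeagre]
    filter_upwards [h] with x hx
    have : (x ∈ M) = (x ∈ U) := hx
    simp [this]

/-- Two continuous open maps into a space in which `U \ M` is meagre. -/
theorem exists_mem_of_isMeagre_diff {Z Q : Type} [TopologicalSpace Z] [TopologicalSpace Q]
    [BaireSpace Q] [Nonempty Q] {U M : Set Z} (hM : IsMeagre (U \ M)) {a b : Q → Z}
    (ha : Continuous a) (hao : IsOpenMap a) (hb : Continuous b) (hbo : IsOpenMap b)
    (haU : ∀ q, a q ∈ U) (hbU : ∀ q, b q ∈ U) : ∃ q, a q ∈ M ∧ b q ∈ M := by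
  have h1 := hM.preimage_of_isOpenMap ha hao
  have h2 := hM.preimage_of_isOpenMap hb hbo
  by_contra! hcon
  refine not_isMeagre_of_isOpen (X := Q) isOpen_univ univ_nonempty ((h1.union h2).mono ?_)
  intro q _
  by_cases hq : a q ∈ M
  · exact Or.inr ⟨hbU q, hcon q hq⟩
  · exact Or.inl ⟨haU q, hq⟩

theorem isMeagre_of_indepSet_of_convSit {Z : Type} [t : TopologicalSpace Z]
    {D : ℕ → Set Z} {f : ℕ → Z → Z} (h : ConvSit Z t D f) {M : Set Z}
    (hM : @MeasurableSet Z (borel Z) M) (hind : IndepSet D f M) : IsMeagre M := by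
  obtain ⟨-, hpol, -, -, hpart, hdiag⟩ := h
  borelize Z
  by_contra hne
  obtain ⟨U, hU, ⟨z, hz⟩, hUM⟩ := exists_isOpen_isMeagre_diff hM hne
  have hzz : ((z, z) : Z × Z) ∈ closure (unionGraphs D f) := by
    have : ((z, z) : Z × Z) ∈ diagonal Z := rfl
    rw [hdiag] at this
    exact this.1
  obtain ⟨⟨x, y⟩, hxyU, hxy⟩ := mem_closure_iff.1 hzz (U ×ˢ U) (hU.prod hU) ⟨hz, hz⟩
  obtain ⟨n, hxD, rfl⟩ : ∃ n, x ∈ D n ∧ y = f n x := by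
    simpa [unionGraphs, graphRel] using hxy
  obtain ⟨hD, hR, hfc, g, hgc, hgf⟩ := hpart n
  have hQ : IsOpen (U ∩ (D n ∩ f n ⁻¹' U)) := hU.inter (hfc.isOpen_inter_preimage hD.2 hU)
  have : PolishSpace ↥(U ∩ (D n ∩ f n ⁻¹' U)) := hQ.polishSpace
  have : Nonempty ↥(U ∩ (D n ∩ f n ⁻¹' U)) := ⟨⟨x, hxyU.1, hxD, hxyU.2⟩⟩
  have hopen : IsOpenMap (fun q : ↥(U ∩ (D n ∩ f n ⁻¹' U)) => f n q) := by
    intro O hO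
    have hO' : IsOpen (Subtype.val '' O) := hQ.isOpenMap_subtype_val O hO
    have := hgc.isOpen_inter_preimage hR.2 hO'
    convert this using 1
    ext w
    constructor
    · rintro ⟨q, hq, rfl⟩
      refine ⟨⟨q, q.2.2.1, rfl⟩, q, hq, ?_⟩
      exact (hgf q q.2.2.1).symm
    · rintro ⟨⟨x, hx, rfl⟩, q, hq, hqx⟩
      rw [hgf x hx] at hqx
      exact ⟨q, hq, congrArg (f n) hqx⟩
  obtain ⟨q, hq1, hq2⟩ := exists_mem_of_isMeagre_diff hUM
    (a := fun q : ↥(U ∩ (D n ∩ f n ⁻¹' U)) => (q : Z)) continuous_subtype_val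
    hQ.isOpenMap_subtype_val
    (hfc.comp_continuous continuous_subtype_val fun q => q.2.2.1) hopen
    (fun q => q.2.1) (fun q => q.2.2.2)
  exact hind n q hq1 q.2.2.1 hq2

theorem not_cover_of_convSit {Z : Type} [t : TopologicalSpace Z]
    {D : ℕ → Set Z} {f : ℕ → Z → Z} (h : ConvSit Z t D f) {ι : Type} [Countable ι]
    (M : ι → Set Z) (hM : ∀ i, @MeasurableSet Z (borel Z) (M i)) (hind : ∀ i, IndepSet D f (M i))
    (hcov : ⋃ i, M i = univ) : False := by
  have := h.1
  have := h.2.1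
  refine not_isMeagre_of_isOpen (X := Z) isOpen_univ univ_nonempty ?_
  rw [← hcov]
  exact isMeagre_iUnion fun i => isMeagre_of_indepSet_of_convSit h (hM i) (hind i)

theorem measurable_borel_of_continuous {Z Y : Type} {t : TopologicalSpace Z}
    {tY : TopologicalSpace Y} {u : Z → Y} (hu : Continuous u) :
    @Measurable Z Y (borel Z) (borel Y) u := by
  borelize Z
  borelize Y
  exact hu.measurable

theorem not_redRC_of_potClosed {Y Y' Z : Type} {tY : TopologicalSpace Y}
    {tY' : TopologicalSpace Y'} (hY : @PolishSpace Y tY) (hY' : @PolishSpace Y' tY')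
    {t : TopologicalSpace Z} {D : ℕ → Set Z} {f : ℕ → Z → Z} (h : ConvSit Z t D f)
    {A : Set (Y × Y')} (hA : PotClosed tY tY' A)
    (hred : RedRC t t tY tY' (unionGraphs D f) A) : False := by
  obtain ⟨σ, τ, hσ, hτ, hσP, hτP, hcl⟩ := hA
  obtain ⟨u, v, hu, hv, huv⟩ := hred
  have hum : @Measurable Z Y (borel Z) (@borel Y σ) u := by
    rw [borel_eq_borel_of_le hσP hY hσ]
    exact measurable_borel_of_continuous hu
  have hvm : @Measurable Z Y' (borel Z) (@borel Y' τ) v := by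
    rw [borel_eq_borel_of_le hτP hY' hτ]
    exact measurable_borel_of_continuous hv
  let I := {p : TopologicalSpace.countableBasis Y × TopologicalSpace.countableBasis Y' //
    (p.1 : Set Y) ×ˢ (p.2 : Set Y') ⊆ Aᶜ}
  refine not_cover_of_convSit h (ι := I)
    (fun i => u ⁻¹' (i.1.1 : Set Y) ∩ v ⁻¹' (i.1.2 : Set Y')) ?_ ?_ ?_
  · intro i
    refine @MeasurableSet.inter _ (borel Z) _ _ (hum ?_) (hvm ?_)
    · exact MeasurableSpace.measurableSet_generateFrom
        (TopologicalSpace.isOpen_of_mem_countableBasis i.1.1.2)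
    · exact MeasurableSpace.measurableSet_generateFrom
        (TopologicalSpace.isOpen_of_mem_countableBasis i.1.2.2)
  · rintro ⟨⟨O, O'⟩, hO⟩ n x hx hxD hfx
    have hm : (x, f n x) ∈ unionGraphs D f := mem_iUnion.2 ⟨n, hxD, rfl⟩
    rw [huv] at hm
    exact hO (a := (u x, v (f n x))) ⟨hx.1, hfx.2⟩ hm
  · refine eq_univ_of_forall fun z => ?_
    have hz : (u z, v z) ∈ Aᶜ := by
      intro hz
      have hm : (z, z) ∈ unionGraphs D f := by rw [huv]; exact hz
      have : ((z, z) : Z × Z) ∈ diagonal Z := rfl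
      rw [h.2.2.2.2.2] at this
      exact this.2 hm
    obtain ⟨W, hW, hzW, hWA⟩ := ((TopologicalSpace.isBasis_countableBasis Y).prod
      (TopologicalSpace.isBasis_countableBasis Y')).exists_subset_of_mem_open hz
        hcl.isOpen_compl
    obtain ⟨O, hO, O', hO', rfl⟩ := hW
    exact mem_iUnion.2 ⟨⟨⟨⟨O, hO⟩, ⟨O', hO'⟩⟩, hWA⟩, hzW⟩

theorem potClosed_of_cover {X Y Y' : Type} [TopologicalSpace X] [T2Space X]
    [MeasurableSpace X] [BorelSpace X]
    [tY : TopologicalSpace Y] [tY' : TopologicalSpace Y'] [hY : PolishSpace Y]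
    [hY' : PolishSpace Y'] {D : ℕ → Set X} {f : ℕ → X → X}
    (hdiag : diagonal X = closure (unionGraphs D f) \ unionGraphs D f)
    {u : Y → X} {v : Y' → X} (hu : Continuous u) (hv : Continuous v) {ι : Type} [Countable ι]
    (C : ι → Set X)
    (hC : ∀ i, MeasurableSet (C i)) (hind : ∀ i, IndepSet D f (C i))
    (hcov : ∀ y y', u y = v y' → ∃ i, u y ∈ C i) :
    PotClosed tY tY' ((fun p : Y × Y' => (u p.1, v p.2)) ⁻¹' unionGraphs D f) := by
  borelize Y
  borelize Y'
  have hc1 : ∀ i, PolishSpace.IsClopenable (u ⁻¹' C i) := fun i =>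
    (hu.measurable (hC i)).isClopenable
  have hc2 : ∀ i, PolishSpace.IsClopenable (v ⁻¹' C i) := fun i =>
    (hv.measurable (hC i)).isClopenable
  choose m1 hm1 hp1 _ ho1 using hc1
  choose m2 hm2 hp2 _ ho2 using hc2
  obtain ⟨σ, hσ, hσY, hσP⟩ := PolishSpace.exists_polishSpace_forall_le m1 hm1 hp1
  obtain ⟨τ, hτ, hτY, hτP⟩ := PolishSpace.exists_polishSpace_forall_le m2 hm2 hp2
  refine ⟨σ, τ, hσY, hτY, hσP, hτP, ?_⟩
  have hcont : @Continuous (Y × Y') (X × X) (@instTopologicalSpaceProd Y Y' σ τ) _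
      (fun p : Y × Y' => (u p.1, v p.2)) := by
    have hu' : @Continuous Y X σ _ u := continuous_le_dom hσY hu
    have hv' : @Continuous Y' X τ _ v := continuous_le_dom hτY hv
    exact (hu'.comp (@continuous_fst _ _ σ τ)).prodMk (hv'.comp (@continuous_snd _ _ σ τ))
  have heq : (fun p : Y × Y' => (u p.1, v p.2)) ⁻¹' unionGraphs D f =
      (fun p : Y × Y' => (u p.1, v p.2)) ⁻¹' closure (unionGraphs D f) \
        ⋃ i, (u ⁻¹' C i) ×ˢ (v ⁻¹' C i) := by
    ext ⟨y, y'⟩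
    constructor
    · intro h
      refine ⟨subset_closure h, ?_⟩
      rw [mem_iUnion]
      rintro ⟨i, hi⟩
      obtain ⟨n, hxD, hxy⟩ : ∃ n, u y ∈ D n ∧ v y' = f n (u y) := by
        simpa [unionGraphs, graphRel] using h
      refine hind i n (u y) hi.1 hxD ?_
      rw [← hxy]
      exact hi.2
    · rintro ⟨h1, h2⟩
      by_contra h3
      have : (u y, v y') ∈ diagonal X := by
        rw [hdiag]
        exact ⟨h1, h3⟩
      obtain ⟨i, hi⟩ := hcov y y' this
      refine h2 (mem_iUnion.2 ⟨i, hi, ?_⟩)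
      have h' : u y = v y' := this
      rw [h'] at hi
      exact hi
  rw [heq]
  have hopen : @IsOpen (Y × Y') (@instTopologicalSpaceProd Y Y' σ τ)
      (⋃ i, (u ⁻¹' C i) ×ˢ (v ⁻¹' C i)) :=
    @isOpen_iUnion _ _ (@instTopologicalSpaceProd Y Y' σ τ) _ fun i =>
      @IsOpen.prod _ _ σ τ _ _ (hσ i _ (ho1 i)) (hτ i _ (ho2 i))
  have hclosed : @IsClosed (Y × Y') (@instTopologicalSpaceProd Y Y' σ τ)
      ((fun p : Y × Y' => (u p.1, v p.2)) ⁻¹' closure (unionGraphs D f)) :=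
    @IsClosed.preimage _ _ (@instTopologicalSpaceProd Y Y' σ τ) _ _ hcont _ isClosed_closure
  exact hclosed.sdiff hopen

theorem exists_measurable_indepSet {X : Type} [TopologicalSpace X] [PolishSpace X]
    [MeasurableSpace X] [BorelSpace X] {D : ℕ → Set X} {f : ℕ → X → X}
    (hD : ∀ n, IsClosed (D n)) (hf : ∀ n, ContinuousOn (f n) (D n)) {N : Set X}
    (hN : AnalyticSet N) (hind : IndepSet D f N) :
    ∃ C, MeasurableSet C ∧ N ⊆ C ∧ IndepSet D f C := by
  have hsep : ∀ n, MeasurablySeparable N (f n '' (N ∩ D n)) := by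
    intro n
    refine hN.measurablySeparable ?_ ?_
    · refine AnalyticSet.image_of_continuousOn ?_ ((hf n).mono inter_subset_right)
      rw [inter_eq_iInter]
      refine AnalyticSet.iInter fun b => ?_
      cases b
      · exact (hD n).analyticSet
      · exact hN
    · rw [disjoint_right]
      rintro _ ⟨x, ⟨hx, hxD⟩, rfl⟩
      exact hind n x hx hxD
  choose S hNS hdis hS using hsep
  refine ⟨⋂ n, (S n ∩ (D n ∩ f n ⁻¹' ⋂ m, S m)ᶜ), ?_, ?_, ?_⟩
  · refine MeasurableSet.iInter fun n => (hS n).inter (MeasurableSet.compl ?_)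
    have : D n ∩ f n ⁻¹' (⋂ m, S m) = Subtype.val '' ((D n).domRestrict (f n) ⁻¹' ⋂ m, S m) := by
      ext x
      simp [domRestrict, and_comm]
    rw [this]
    refine (hD n).measurableSet.subtype_image ?_
    exact (continuousOn_iff_continuous_domRestrict.1 (hf n)).measurable (MeasurableSet.iInter hS)
  · intro x hx
    refine mem_iInter.2 fun n => ⟨hNS n hx, ?_⟩
    rintro ⟨hxD, hfx⟩
    exact disjoint_left.1 (hdis n) ⟨x, ⟨hx, hxD⟩, rfl⟩ (mem_iInter.1 hfx n)
  · intro n x hx hxD hfx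
    refine (mem_iInter.1 hx n).2 ⟨hxD, ?_⟩
    exact mem_iInter.2 fun m => (mem_iInter.1 hfx m).1

/-- The restriction of an infinite binary sequence to its first `n` terms. -/
def initSeg (n : ℕ) (γ : Cantor) : Fin n → Bool := fun i => γ i

/-- `x : 2ⁿ → E` labels the `k`-th edges below the sequences `b k` by the `m k`-th maps. -/
def IsConfig {X E : Type} (D : ℕ → Set X) (f : ℕ → X → X) (φ : E → X) (b : ℕ → Cantor) {n : ℕ}
    (m : Fin n → ℕ) (x : (Fin n → Bool) → E) : Prop :=
  ∀ (k : Fin n) (s : Fin n → Bool), (∀ i : Fin n, i < k → s i = b k i) → s k = false →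
    φ (x s) ∈ D (m k) ∧ φ (x (Function.update s k true)) = f (m k) (φ (x s))

/-- Base points of the configurations with values in the `U s` and in `φ ⁻¹' T`. -/
def configSet {X E : Type} (D : ℕ → Set X) (f : ℕ → X → X) (φ : E → X) (b : ℕ → Cantor)
    (T : Set X) {n : ℕ} (m : Fin n → ℕ) (U : (Fin n → Bool) → Set E) : Set X :=
  (fun x : (Fin n → Bool) → E => φ (x (initSeg n (b n)))) ''
    {x | IsConfig D f φ b m x ∧ ∀ s, x s ∈ U s ∧ φ (x s) ∈ T}

theorem isClosed_graphRel {X : Type} [TopologicalSpace X] [T2Space X] {D : Set X} {f : X → X}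
    (hD : IsClosed D) (hf : ContinuousOn f D) : IsClosed (graphRel D f) := by
  have hc : ContinuousOn (fun p : X × X => (p.2, f p.1)) (Prod.fst ⁻¹' D) :=
    continuousOn_snd.prodMk (hf.comp continuousOn_fst fun p hp => hp)
  exact hc.preimage_isClosed_of_isClosed (hD.preimage continuous_fst) (isClosed_diagonal (X := X))

theorem isClosed_isConfig {X E : Type} [TopologicalSpace X] [T2Space X] [TopologicalSpace E]
    {D : ℕ → Set X} {f : ℕ → X → X} {φ : E → X}
    (hD : ∀ n, IsClosed (D n)) (hf : ∀ n, ContinuousOn (f n) (D n))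
    (hφ : Continuous φ) (b : ℕ → Cantor) {n : ℕ} (m : Fin n → ℕ) :
    IsClosed {x : (Fin n → Bool) → E | IsConfig D f φ b m x} := by
  simp only [IsConfig, ofPred_forall]
  refine isClosed_iInter fun k => isClosed_iInter fun s => isClosed_iInter fun _ =>
    isClosed_iInter fun _ => ?_
  exact (isClosed_graphRel (hD (m k)) (hf (m k))).preimage ((hφ.comp (continuous_apply s)).prodMk
    (hφ.comp (continuous_apply (Function.update s k true))))

theorem analyticSet_configSet {X E : Type} [TopologicalSpace X] [PolishSpace X]
    [MeasurableSpace X] [BorelSpace X] [TopologicalSpace E] [PolishSpace E]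
    {D : ℕ → Set X} {f : ℕ → X → X} {φ : E → X}
    (hD : ∀ n, IsClosed (D n)) (hf : ∀ n, ContinuousOn (f n) (D n))
    (hφ : Continuous φ) (b : ℕ → Cantor) {T : Set X} (hT : MeasurableSet T) {n : ℕ}
    (m : Fin n → ℕ) {U : (Fin n → Bool) → Set E} (hU : ∀ s, IsOpen (U s)) :
    AnalyticSet (configSet D f φ b T m U) := by
  borelize E
  refine MeasurableSet.analyticSet_image ?_ (hφ.comp (continuous_apply _)).measurable
  have h : MeasurableSet (⋂ s, {x : (Fin n → Bool) → E | x s ∈ U s ∧ φ (x s) ∈ T}) :=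
    MeasurableSet.iInter fun s => ((hU s).preimage (continuous_apply s)).measurableSet.inter
      ((hφ.comp (continuous_apply s)).measurable hT)
  convert (isClosed_isConfig hD hf hφ b m).measurableSet.inter h using 1
  ext x
  simp

/-- Two configurations joined along an edge between their base points. -/
theorem IsConfig.snoc {X E : Type} {D : ℕ → Set X} {f : ℕ → X → X} {φ : E → X}
    {b : ℕ → Cantor} {n : ℕ} {m : Fin n → ℕ} {x x' : (Fin n → Bool) → E}
    (hx : IsConfig D f φ b m x) (hx' : IsConfig D f φ b m x') {l : ℕ}
    (h : φ (x (initSeg n (b n))) ∈ D l)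
    (h' : φ (x' (initSeg n (b n))) = f l (φ (x (initSeg n (b n))))) :
    IsConfig D f φ b (Fin.snoc m l : Fin (n + 1) → ℕ)
      (fun s : Fin (n + 1) → Bool => if s (Fin.last n) then x' (Fin.init s) else x (Fin.init s)) := by
  intro k s hs hk
  induction k using Fin.lastCases with
  | last =>
    have hinit : (Fin.init s : Fin n → Bool) = initSeg n (b n) := by
      funext i
      exact hs i.castSucc (Fin.castSucc_lt_last i)
    simp only [hk, Fin.snoc_last, Function.update_self, Fin.init_update_last, hinit]
    simpa using ⟨h, h'⟩
  | cast k =>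
    have hne : Fin.last n ≠ k.castSucc := (Fin.castSucc_lt_last k).ne'
    have hs' : ∀ i : Fin n, i < k → (Fin.init s : Fin n → Bool) i = b k i := fun i hi =>
      hs i.castSucc (by simpa using hi)
    simp only [Fin.snoc_castSucc, Function.update_of_ne hne, Fin.init_update_castSucc]
    split_ifs
    · exact hx' k _ hs' hk
    · exact hx k _ hs' hk

theorem exists_configSet_not_indepSet {X E : Type} [TopologicalSpace X] [PolishSpace X]
    [MeasurableSpace X] [BorelSpace X] [TopologicalSpace E] [PolishSpace E]
    {D : ℕ → Set X} {f : ℕ → X → X} {φ : E → X}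
    (hD : ∀ n, IsClosed (D n)) (hf : ∀ n, ContinuousOn (f n) (D n))
    (hφ : Continuous φ) (b : ℕ → Cantor) :
    ∃ 𝒞 : Set (Set X), 𝒞.Countable ∧ (∀ C ∈ 𝒞, MeasurableSet C ∧ IndepSet D f C) ∧
      ∀ (n : ℕ) (m : Fin n → ℕ) (U : (Fin n → Bool) → TopologicalSpace.countableBasis E),
        (configSet D f φ b (⋃₀ 𝒞)ᶜ m fun s => U s).Nonempty →
          ¬ IndepSet D f (configSet D f φ b (⋃₀ 𝒞)ᶜ m fun s => U s) := by
  let P : Set (Set X) → Prop := fun 𝒞 =>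
    𝒞.Countable ∧ ∀ C ∈ 𝒞, MeasurableSet C ∧ IndepSet D f C
  let I := Σ n : ℕ, (Fin n → ℕ) × ((Fin n → Bool) → TopologicalSpace.countableBasis E)
  let S : I → Set (Set X) → Set X := fun p 𝒞 =>
    configSet D f φ b (⋃₀ 𝒞)ᶜ p.2.1 fun s => p.2.2 s
  have hanti : ∀ (p : I) (𝒞 𝒞' : Set (Set X)), 𝒞 ⊆ 𝒞' → S p 𝒞' ⊆ S p 𝒞 := by
    rintro p 𝒞 𝒞' h _ ⟨x, ⟨hx, hxU⟩, rfl⟩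
    exact ⟨x, ⟨hx, fun s => ⟨(hxU s).1, fun hs => (hxU s).2 (sUnion_mono h hs)⟩⟩, rfl⟩
  have hchoice : ∀ p : I, ∃ 𝒞, P 𝒞 ∧ ((∃ 𝒞', P 𝒞' ∧ S p 𝒞' = ∅) → S p 𝒞 = ∅) := by
    intro p
    by_cases h : ∃ 𝒞', P 𝒞' ∧ S p 𝒞' = ∅
    · obtain ⟨𝒞', h1, h2⟩ := h
      exact ⟨𝒞', h1, fun _ => h2⟩
    · exact ⟨∅, ⟨countable_empty, by simp⟩, fun h' => absurd h' h⟩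
  choose 𝒟 h𝒟 h𝒟' using hchoice
  have hP : P (⋃ p, 𝒟 p) := by
    refine ⟨countable_iUnion fun p => (h𝒟 p).1, fun C hC => ?_⟩
    obtain ⟨p, hp⟩ := mem_iUnion.1 hC
    exact (h𝒟 p).2 C hp
  refine ⟨⋃ p, 𝒟 p, hP.1, hP.2, fun n m U hne hind => ?_⟩
  have hT : MeasurableSet (⋃₀ ⋃ p, 𝒟 p)ᶜ :=
    (MeasurableSet.sUnion hP.1 fun C hC => (hP.2 C hC).1).compl
  obtain ⟨C, hC, hNC, hCind⟩ := exists_measurable_indepSet hD hf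
    (analyticSet_configSet hD hf hφ b hT m
      fun s => TopologicalSpace.isOpen_of_mem_countableBasis (U s).2) hind
  have hempty : S ⟨n, m, U⟩ (insert C (⋃ p, 𝒟 p)) = ∅ := by
    rw [eq_empty_iff_forall_notMem]
    intro z hz
    have hzC : z ∈ C := hNC (hanti ⟨n, m, U⟩ _ _ (subset_insert _ _) hz)
    obtain ⟨x, ⟨-, hxU⟩, rfl⟩ := hz
    exact (hxU _).2 (mem_sUnion.2 ⟨C, mem_insert _ _, hzC⟩)
  have := h𝒟' ⟨n, m, U⟩ ⟨_, ⟨hP.1.insert C, by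
    rintro C' (rfl | hC')
    · exact ⟨hC, hCind⟩
    · exact hP.2 C' hC'⟩, hempty⟩
  obtain ⟨z, hz⟩ := hne
  have := this ▸ hanti ⟨n, m, U⟩ _ _ (subset_iUnion 𝒟 ⟨n, m, U⟩) hz
  exact this

/-- A configuration extending the shape `(m, U)` by one level, with small values. -/
theorem exists_configSet_succ {X E : Type} [MetricSpace E] [SecondCountableTopology E]
    {D : ℕ → Set X} {f : ℕ → X → X} {φ : E → X} {b : ℕ → Cantor} {T : Set X} {n : ℕ}
    {m : Fin n → ℕ} {U : (Fin n → Bool) → TopologicalSpace.countableBasis E}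
    (h : ¬ IndepSet D f (configSet D f φ b T m fun s => U s)) {ε : ℝ} (hε : 0 < ε) :
    ∃ (l : ℕ) (U' : (Fin (n + 1) → Bool) → TopologicalSpace.countableBasis E),
      (∀ s, (U' s : Set E) ⊆ U (Fin.init s)) ∧
      (∀ s, ∀ y ∈ (U' s : Set E), ∀ z ∈ (U' s : Set E), dist y z ≤ ε) ∧
      (configSet D f φ b T (Fin.snoc m l : Fin (n + 1) → ℕ) fun s => U' s).Nonempty := by
  simp only [IndepSet, not_forall, not_not] at h
  obtain ⟨l, z, ⟨x, ⟨hx, hxU⟩, rfl⟩, hl, ⟨x', ⟨hx', hxU'⟩, hxx'⟩⟩ := h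
  let y : (Fin (n + 1) → Bool) → E := fun s =>
    if s (Fin.last n) then x' (Fin.init s) else x (Fin.init s)
  have hy : ∀ s, y s ∈ (U (Fin.init s) : Set E) ∧ φ (y s) ∈ T := by
    intro s
    simp only [y]
    split_ifs
    · exact hxU' _
    · exact hxU _
  have hU' : ∀ s : Fin (n + 1) → Bool, ∃ V : TopologicalSpace.countableBasis E,
      y s ∈ (V : Set E) ∧ (V : Set E) ⊆ (U (Fin.init s) : Set E) ∩ Metric.ball (y s) (ε / 2) := by
    intro s
    obtain ⟨V, hV, h1, h2⟩ :=
      (TopologicalSpace.isBasis_countableBasis E).exists_subset_of_mem_open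
        (show y s ∈ (U (Fin.init s) : Set E) ∩ Metric.ball (y s) (ε / 2) from
          ⟨(hy s).1, Metric.mem_ball_self (half_pos hε)⟩)
        ((TopologicalSpace.isOpen_of_mem_countableBasis (U (Fin.init s)).2).inter
          Metric.isOpen_ball)
    exact ⟨⟨V, hV⟩, h1, h2⟩
  choose U' hyU' hU' using hU'
  refine ⟨l, U', fun s => (hU' s).trans inter_subset_left, fun s p hp q hq => ?_,
    _, y, ⟨hx.snoc hx' hl hxx', fun s => ⟨hyU' s, (hy s).2⟩⟩, rfl⟩
  have h1 := (hU' s hp).2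
  have h2 := (hU' s hq).2
  rw [Metric.mem_ball] at h1 h2
  have := dist_triangle_right p q (y s)
  linarith

theorem exists_nested_shapes {X E : Type} [MetricSpace E] [SecondCountableTopology E]
    {D : ℕ → Set X} {f : ℕ → X → X} {φ : E → X} {b : ℕ → Cantor} {T : Set X}
    (hT : ∃ e, φ e ∈ T)
    (h : ∀ (n : ℕ) (m : Fin n → ℕ) (U : (Fin n → Bool) → TopologicalSpace.countableBasis E),
        (configSet D f φ b T m fun s => U s).Nonempty →
          ¬ IndepSet D f (configSet D f φ b T m fun s => U s)) :
    ∃ (m : ℕ → ℕ) (U : (n : ℕ) → (Fin n → Bool) → TopologicalSpace.countableBasis E),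
      (∀ n s, (U (n + 1) s : Set E) ⊆ U n (Fin.init s)) ∧
      (∀ n s, ∀ y ∈ (U (n + 1) s : Set E), ∀ z ∈ (U (n + 1) s : Set E),
        dist y z ≤ 2 / 2 / 2 ^ n) ∧
      ∀ n, (configSet D f φ b T (fun i : Fin n => m i) fun s => U n s).Nonempty := by
  let Stage : ℕ → Type := fun n =>
    {p : (Fin n → ℕ) × ((Fin n → Bool) → TopologicalSpace.countableBasis E) //
      (configSet D f φ b T p.1 fun s => p.2 s).Nonempty}
  have hstep : ∀ n (p : Stage n), ∃ q : Stage (n + 1),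
      (∃ l, q.1.1 = (Fin.snoc p.1.1 l : Fin (n + 1) → ℕ)) ∧
      (∀ s, (q.1.2 s : Set E) ⊆ p.1.2 (Fin.init s)) ∧
      (∀ s, ∀ y ∈ (q.1.2 s : Set E), ∀ z ∈ (q.1.2 s : Set E), dist y z ≤ 2 / 2 / 2 ^ n) := by
    intro n p
    obtain ⟨l, U', h1, h2, h3⟩ := exists_configSet_succ (h n p.1.1 p.1.2 p.2)
      (ε := 2 / 2 / 2 ^ n) (by positivity)
    exact ⟨⟨(_, U'), h3⟩, ⟨l, rfl⟩, h1, h2⟩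
  choose next hl hsub hdist using hstep
  obtain ⟨e, he⟩ := hT
  obtain ⟨V, hV, heV, -⟩ := (TopologicalSpace.isBasis_countableBasis E).exists_subset_of_mem_open
    (mem_univ e) isOpen_univ
  let p0 : Stage 0 := ⟨(Fin.elim0, fun _ => ⟨V, hV⟩), _, fun _ => e,
    ⟨fun k => k.elim0, fun s => ⟨heV, he⟩⟩, rfl⟩
  let seq : ∀ n, Stage n := fun n => Nat.rec p0 (fun n p => next n p) n
  have hseq : ∀ n, seq (n + 1) = next n (seq n) := fun n => rfl
  let m : ℕ → ℕ := fun k => (seq (k + 1)).1.1 (Fin.last k)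
  have hm : ∀ n, (seq n).1.1 = fun i : Fin n => m i := by
    intro n
    induction n with
    | zero => exact funext fun i => i.elim0
    | succ n ih =>
      funext i
      induction i using Fin.lastCases with
      | last => rfl
      | cast i =>
        obtain ⟨l, hl⟩ := hl n (seq n)
        rw [hseq, hl, Fin.snoc_castSucc, ih]
        rfl
  refine ⟨m, fun n => (seq n).1.2, fun n => hsub n (seq n), fun n => hdist n (seq n), fun n => ?_⟩
  rw [← hm]
  exact (seq n).2

/-- Unless `φ` has range covered by countably many Borel independent sets, some continuous
image of the Cantor space in `E` is a homomorphic image of the edges prescribed by `b`. -/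
theorem exists_continuous_homomorphism {X E : Type} [TopologicalSpace X] [PolishSpace X]
    [MeasurableSpace X] [BorelSpace X] [TopologicalSpace E] [PolishSpace E]
    {D : ℕ → Set X} {f : ℕ → X → X} {φ : E → X}
    (hD : ∀ n, IsClosed (D n)) (hf : ∀ n, ContinuousOn (f n) (D n))
    (hφ : Continuous φ) (b : ℕ → Cantor)
    (hcov : ∀ 𝒞 : Set (Set X), 𝒞.Countable → (∀ C ∈ 𝒞, MeasurableSet C ∧ IndepSet D f C) →
      ∃ e, φ e ∉ ⋃₀ 𝒞) :
    ∃ ψ : Cantor → E, Continuous ψ ∧ ∀ (k : ℕ) (γ : Cantor), (∀ i < k, γ i = b k i) →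
      γ k = false → (φ (ψ γ), φ (ψ (Function.update γ k true))) ∈ unionGraphs D f := by
  obtain ⟨𝒞, h𝒞, h𝒞', hne⟩ := exists_configSet_not_indepSet hD hf hφ b
  let := TopologicalSpace.upgradeIsCompletelyMetrizable E
  obtain ⟨m, U, hsub, hdist, hconf⟩ := exists_nested_shapes (hcov 𝒞 h𝒞 h𝒞') hne
  choose z x hx hxz using hconf
  let y : ℕ → Cantor → E := fun n γ => x n (initSeg n γ)
  have hyc : ∀ n, Continuous (y n) := fun n =>
    (continuous_of_discreteTopology (f := x n)).comp
      (continuous_pi fun i => continuous_apply (i : ℕ))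
  have hyd : ∀ γ n, dist (y (n + 1) γ) (y (n + 2) γ) ≤ 2 / 2 / 2 ^ n := fun γ n =>
    hdist n (initSeg (n + 1) γ) _ ((hx (n + 1)).2 _).1 _
      (hsub (n + 1) (initSeg (n + 2) γ) ((hx (n + 2)).2 (initSeg (n + 2) γ)).1)
  have hlim : ∀ γ, ∃ l, Filter.Tendsto (fun n => y (n + 1) γ) Filter.atTop (𝓝 l) := fun γ =>
    cauchySeq_tendsto_of_complete (cauchySeq_of_le_geometric_two (C := 2) (hyd γ))
  choose ψ hψ using hlim
  refine ⟨ψ, ?_, ?_⟩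
  · have hunif : TendstoUniformly (fun n γ => y (n + 1) γ) ψ Filter.atTop := by
      rw [Metric.tendstoUniformly_iff]
      intro ε hε
      have hgeom : Filter.Tendsto (fun n : ℕ => (2 : ℝ) / 2 ^ n) Filter.atTop (𝓝 0) := by
        have := (tendsto_pow_atTop_nhds_zero_of_lt_one (r := (1 / 2 : ℝ)) (by norm_num)
          (by norm_num)).const_mul 2
        simpa [div_eq_mul_inv] using this
      filter_upwards [hgeom.eventually (gt_mem_nhds hε)] with n hn γ
      rw [dist_comm]
      exact (dist_le_of_le_geometric_two_of_tendsto (C := 2) (hyd γ) (hψ γ) n).trans_lt hn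
    exact hunif.continuous (Filter.Frequently.of_forall fun n => hyc (n + 1))
  · intro k γ hγ hk
    refine mem_iUnion.2 ⟨m k, ?_⟩
    have hlim : Filter.Tendsto
        (fun n => (φ (y (n + 1) γ), φ (y (n + 1) (Function.update γ k true)))) Filter.atTop
        (𝓝 (φ (ψ γ), φ (ψ (Function.update γ k true)))) :=
      ((hφ.tendsto _).comp (hψ γ)).prodMk_nhds ((hφ.tendsto _).comp (hψ _))
    refine (isClosed_graphRel (hD (m k)) (hf (m k))).mem_of_tendsto hlim ?_
    filter_upwards [Filter.eventually_ge_atTop k] with n hn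
    have hkn : k < n + 1 := by omega
    have := (hx (n + 1)).1 ⟨k, hkn⟩ (initSeg (n + 1) γ) (fun i hi => hγ i hi) hk
    have hupd : Function.update (initSeg (n + 1) γ) ⟨k, hkn⟩ true =
        initSeg (n + 1) (Function.update γ k true) := by
      funext i
      simp [initSeg, Function.update_apply, Fin.ext_iff]
    rw [hupd] at this
    exact this

theorem exists_seq_initSeg_dense : ∃ b : ℕ → Cantor, ∀ U : Set Cantor, IsOpen U → U.Nonempty →
    ∃ k, ∀ γ : Cantor, (∀ i < k, γ i = b k i) → γ ∈ U := by
  refine ⟨fun n => TopologicalSpace.denseSeq Cantor n.unpair.1, fun U hU hne => ?_⟩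
  obtain ⟨j, hj⟩ := (TopologicalSpace.denseRange_denseSeq Cantor).exists_mem_open hU hne
  obtain ⟨N, hN⟩ : ∃ N, ∀ γ : Cantor, (∀ i < N, γ i = TopologicalSpace.denseSeq Cantor j i) →
      γ ∈ U := by
    rw [isOpen_pi_iff] at hU
    obtain ⟨I, u, hu, hIU⟩ := hU _ hj
    obtain ⟨N, hN⟩ := I.bddAbove
    refine ⟨N + 1, fun γ hγ => hIU fun i hi => ?_⟩
    rw [hγ i (Nat.lt_succ_of_le (hN hi))]
    exact (hu i hi).2
  refine ⟨Nat.pair j N, fun γ hγ => hN γ fun i hi => ?_⟩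
  have := hγ i (hi.trans_le (Nat.right_le_pair j N))
  simpa using this

theorem exists_edge_of_not_isMeagre {b : ℕ → Cantor}
    (hb : ∀ U : Set Cantor, IsOpen U → U.Nonempty →
      ∃ k, ∀ γ : Cantor, (∀ i < k, γ i = b k i) → γ ∈ U)
    {M : Set Cantor} (hM : MeasurableSet M) (hne : ¬ IsMeagre M) :
    ∃ (k : ℕ) (γ : Cantor), (∀ i < k, γ i = b k i) ∧ γ k = false ∧ γ ∈ M ∧
      Function.update γ k true ∈ M := by
  obtain ⟨U, hU, hUne, hUM⟩ := exists_isOpen_isMeagre_diff hM hne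
  obtain ⟨k, hk⟩ := hb U hU hUne
  let Q : Set Cantor := {γ | ∀ i < k, γ i = b k i}
  have hQ : IsOpen Q := by
    have : Q = ⋂ i ∈ Finset.range k, {γ : Cantor | γ i = b k i} := by
      ext γ
      simp [Q]
    rw [this]
    exact isOpen_biInter_finset fun i _ =>
      (isOpen_discrete {b k i}).preimage (continuous_apply (A := fun _ => Bool) i)
  have hk' : Continuous fun γ : Cantor => !γ k :=
    (continuous_of_discreteTopology (f := fun c : Bool => !c)).comp
      (continuous_apply (A := fun _ => Bool) k)
  let e : Cantor ≃ₜ Cantor :=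
    { toFun := fun γ => Function.update γ k (!γ k)
      invFun := fun γ => Function.update γ k (!γ k)
      left_inv := fun γ => by simp
      right_inv := fun γ => by simp
      continuous_toFun := continuous_id.update k
        hk'
      continuous_invFun := continuous_id.update k
        hk' }
  have heQ : ∀ γ ∈ Q, e γ ∈ Q := fun γ hγ i hi => by
    have : e γ i = γ i := Function.update_of_ne hi.ne _ _
    rw [this, hγ i hi]
  have : BaireSpace Q := hQ.baireSpace
  have : Nonempty Q := ⟨⟨b k, fun _ _ => rfl⟩⟩
  obtain ⟨⟨γ, hγQ⟩, hγ, heγ⟩ := exists_mem_of_isMeagre_diff hUM (a := fun q : Q => (q : Cantor))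
    (b := fun q : Q => e q) continuous_subtype_val hQ.isOpenMap_subtype_val
    (e.continuous.comp continuous_subtype_val) (e.isOpenMap.comp hQ.isOpenMap_subtype_val)
    (fun q => hk q q.2) (fun q => hk _ (heQ q q.2))
  cases hγk : γ k with
  | false =>
    refine ⟨k, γ, hγQ, hγk, hγ, ?_⟩
    have : e γ = Function.update γ k true := by simp [e, hγk]
    rw [← this]
    exact heγ
  | true =>
    refine ⟨k, e γ, heQ γ hγQ, by simp [e, hγk], heγ, ?_⟩
    have : Function.update (e γ) k true = γ := by simp [e, ← hγk]
    rw [this]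
    exact hγ

/-- A continuous map on the Cantor space has a Borel section. -/
theorem exists_measurable_section {X : Type} [TopologicalSpace X] [PolishSpace X]
    [MeasurableSpace X] [BorelSpace X] {h : Cantor → X} (hh : Continuous h) :
    ∃ s : X → Cantor, Measurable s ∧ ∀ γ, h (s (h γ)) = h γ := by
  obtain ⟨g, hg, hginj⟩ : ∃ g : Cantor → ℝ, Continuous g ∧ Function.Injective g :=
    ⟨fun γ => (cantorSetHomeomorphNatToBool.symm γ : ℝ),
      continuous_subtype_val.comp cantorSetHomeomorphNatToBool.symm.continuous,
      Subtype.val_injective.comp cantorSetHomeomorphNatToBool.symm.injective⟩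
  let Z : Set Cantor := {γ | ∀ γ', h γ' = h γ → g γ ≤ g γ'}
  have hZ : MeasurableSet Z := by
    have : Z = (⋃ q : ℚ, {γ | (q : ℝ) < g γ} ∩
        Prod.fst '' {p : Cantor × Cantor | h p.2 = h p.1 ∧ g p.2 ≤ q})ᶜ := by
      ext γ
      simp only [Z, mem_ofPred_eq, mem_compl_iff, mem_iUnion, not_exists]
      constructor
      · rintro hγ q ⟨hq, ⟨γ1, γ2⟩, ⟨h1, h2⟩, rfl⟩
        exact absurd (hγ γ2 h1) (not_le.2 (h2.trans_lt hq))
      · intro hγ γ' hγ'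
        by_contra! hlt
        obtain ⟨q, hq1, hq2⟩ := exists_rat_btwn hlt
        exact hγ q ⟨hq2, ⟨γ, γ'⟩, ⟨hγ', hq1.le⟩, rfl⟩
    rw [this]
    refine (MeasurableSet.iUnion fun q => ?_).compl
    refine (isOpen_lt continuous_const hg).measurableSet.inter ?_
    refine IsClosed.measurableSet (IsCompact.isClosed (IsCompact.image ?_ continuous_fst))
    exact ((isClosed_eq (hh.comp continuous_snd) (hh.comp continuous_fst)).inter
      (isClosed_le (hg.comp continuous_snd) continuous_const)).isCompact
  have hinj : InjOn h Z := fun a ha c hc hac =>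
    hginj (le_antisymm (ha c hac.symm) (hc a hac))
  have : TopologicalSpace.SeparableSpace Cantor := inferInstance
  have : PolishSpace Cantor := inferInstance
  obtain ⟨s, hs, hsZ⟩ := (hh.continuousOn.measurableEmbedding hZ hinj).exists_measurable_extend
    (g := (Subtype.val : Z → Cantor)) measurable_subtype_coe fun _ => ⟨fun _ => false⟩
  refine ⟨s, hs, fun γ => ?_⟩
  have hcpt : IsCompact (h ⁻¹' {h γ}) := (isClosed_singleton.preimage hh).isCompact
  obtain ⟨γ', hγ', hmin⟩ := hcpt.exists_isMinOn ⟨γ, rfl⟩ hg.continuousOn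
  have hγ'Z : γ' ∈ Z := fun δ hδ => hmin (show h δ = h γ from hδ.trans hγ')
  have := congrFun hsZ ⟨γ', hγ'Z⟩
  simp only [Function.comp, domRestrict] at this
  have hγ'' : h γ' = h γ := hγ'
  rw [← hγ'', this]

theorem exists_countable_exhaustion {Z X : Type} [TopologicalSpace Z] [SecondCountableTopology Z]
    [BaireSpace Z] [MeasurableSpace Z] [BorelSpace Z] [MeasurableSpace X] {h : Z → X}
    (hh : Measurable h) (P : Set X → Prop) (hP : ∀ C, P C → MeasurableSet C) :
    ∃ 𝒮 : Set (Set X), 𝒮.Countable ∧ (∀ C ∈ 𝒮, P C) ∧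
      ∀ C, P C → IsMeagre (h ⁻¹' (C \ ⋃₀ 𝒮)) := by
  let 𝒪 : Set (Set Z) := {O | O ∈ TopologicalSpace.countableBasis Z ∧
    ∃ C, P C ∧ IsMeagre (O \ h ⁻¹' C)}
  have h𝒪 : 𝒪.Countable := (TopologicalSpace.countable_countableBasis Z).mono fun O hO => hO.1
  have hex : ∀ O : 𝒪, ∃ C, P C ∧ IsMeagre ((O : Set Z) \ h ⁻¹' C) := fun O => O.2.2
  choose c hcP hc using hex
  have := h𝒪.to_subtype
  have hcount : (range c).Countable := countable_range c
  refine ⟨range c, hcount, by rintro _ ⟨O, rfl⟩; exact hcP O, fun C hC => ?_⟩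
  by_contra hne
  have hmeas : MeasurableSet (h ⁻¹' (C \ ⋃₀ range c)) :=
    hh ((hP C hC).diff (MeasurableSet.sUnion hcount (by rintro _ ⟨O, rfl⟩; exact hP _ (hcP O))))
  obtain ⟨U, hU, ⟨z, hz⟩, hUM⟩ := exists_isOpen_isMeagre_diff hmeas hne
  obtain ⟨O, hO, hzO, hOU⟩ :=
    (TopologicalSpace.isBasis_countableBasis Z).exists_subset_of_mem_open hz hU
  have h1 : IsMeagre (O \ h ⁻¹' (C \ ⋃₀ range c)) := hUM.mono (sdiff_subset_sdiff_left hOU)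
  have hO𝒪 : O ∈ 𝒪 := ⟨hO, C, hC, h1.mono (sdiff_subset_sdiff_right (preimage_mono sdiff_subset))⟩
  refine not_isMeagre_of_isOpen (TopologicalSpace.isOpen_of_mem_countableBasis hO) ⟨z, hzO⟩
    ((h1.union (hc ⟨O, hO𝒪⟩)).mono fun w hw => ?_)
  by_cases hwc : h w ∈ c ⟨O, hO𝒪⟩
  · exact Or.inl ⟨hw, fun hw' => hw'.2 ⟨_, ⟨_, rfl⟩, hwc⟩⟩
  · exact Or.inr ⟨hw, hwc⟩

theorem exists_isMeagre_nonsingular {Z X : Type} [TopologicalSpace Z] [SecondCountableTopology Z]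
    [BaireSpace Z] [MeasurableSpace Z] [BorelSpace Z] [TopologicalSpace X] [PolishSpace X]
    [MeasurableSpace X] [BorelSpace X] {h : Z → X} (hh : Measurable h) {D : Set X} {f : X → X}
    (hf : ContinuousOn f D) (hinj : InjOn f D) :
    ∃ N, MeasurableSet N ∧ IsMeagre (h ⁻¹' N) ∧ ∀ C ⊆ D, MeasurableSet C → Disjoint C N →
      Disjoint (f '' C) N → (IsMeagre (h ⁻¹' C) ↔ IsMeagre (h ⁻¹' (f '' C))) := by
  have himg : ∀ C ⊆ D, MeasurableSet C → MeasurableSet (f '' C) := fun C hC hCm =>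
    hCm.image_of_continuousOn_injOn (hf.mono hC) (hinj.mono hC)
  obtain ⟨𝒮, h𝒮, h𝒮P, h𝒮C⟩ := exists_countable_exhaustion hh
    (fun C => MeasurableSet C ∧ C ⊆ D ∧ IsMeagre (h ⁻¹' (f '' C))) fun C hC => hC.1
  obtain ⟨𝒯, h𝒯, h𝒯P, h𝒯C⟩ := exists_countable_exhaustion hh
    (fun C' => ∃ C, MeasurableSet C ∧ C ⊆ D ∧ IsMeagre (h ⁻¹' C) ∧ f '' C = C')
    (by rintro _ ⟨C, hC, hCD, -, rfl⟩; exact himg C hCD hC)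
  have := h𝒮.to_subtype
  have := h𝒯.to_subtype
  choose c hc hcD hcM hcf using fun C' : 𝒯 => h𝒯P C' C'.2
  refine ⟨(⋃ C : 𝒮, f '' C) ∪ ⋃ C' : 𝒯, c C', ?_, ?_, ?_⟩
  · exact (MeasurableSet.iUnion fun C : 𝒮 => himg C (h𝒮P C C.2).2.1 (h𝒮P C C.2).1).union
      (MeasurableSet.iUnion hc)
  · rw [preimage_union, preimage_iUnion, preimage_iUnion]
    exact (isMeagre_iUnion fun C : 𝒮 => (h𝒮P C C.2).2.2).union (isMeagre_iUnion hcM)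
  · intro C hCD hCm hCN hfCN
    rw [disjoint_left] at hCN hfCN
    constructor
    · intro hC
      refine (h𝒯C (f '' C) ⟨C, hCm, hCD, hC, rfl⟩).mono (preimage_mono ?_)
      rintro _ ⟨x, hx, rfl⟩
      refine ⟨⟨x, hx, rfl⟩, ?_⟩
      rintro ⟨C', hC', hxC'⟩
      refine hCN hx (Or.inr (mem_iUnion_of_mem (⟨C', hC'⟩ : 𝒯) ?_))
      have hxC'' : f x ∈ f '' c ⟨C', hC'⟩ := by rwa [hcf]
      obtain ⟨x', hx', hfx⟩ : ∃ x' ∈ c ⟨C', hC'⟩, f x' = f x := hxC''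
      rwa [← hinj (hcD _ hx') (hCD hx) hfx]
    · intro hC
      refine (h𝒮C C ⟨hCm, hCD, hC⟩).mono (preimage_mono ?_)
      refine fun x hx => ⟨hx, ?_⟩
      rintro ⟨C', hC', hxC'⟩
      exact hfCN ⟨x, hx, rfl⟩ (Or.inl (mem_iUnion_of_mem (⟨C', hC'⟩ : 𝒮) ⟨x, hxC', rfl⟩))

theorem exists_polishSpace_isClopen {X : Type} [m : MeasurableSpace X] {t : TopologicalSpace X}
    (ht : @PolishSpace X t) (hb : @BorelSpace X t m) {ι : Type} [Countable ι] {S : ι → Set X}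
    (hS : ∀ i, MeasurableSet (S i)) :
    ∃ t' ≤ t, @PolishSpace X t' ∧ @BorelSpace X t' m ∧ ∀ i, @IsClopen X t' (S i) := by
  choose u hut hu hc ho using fun i => (hS i).isClopenable
  obtain ⟨t', ht'u, ht't, ht'⟩ := PolishSpace.exists_polishSpace_forall_le u hut hu
  refine ⟨t', ht't, ht', ⟨?_⟩, fun i => ⟨(hc i).mono (ht'u i), (ht'u i) _ (ho i)⟩⟩
  rw [hb.measurable_eq, borel_eq_borel_of_le ht' ht ht't]

theorem exists_polishSpace_isClopen_preimage {X : Type} [m : MeasurableSpace X]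
    {t : TopologicalSpace X}
    (ht : @PolishSpace X t) (hb : @BorelSpace X t m) {ι κ : Type} [Countable ι] [Countable κ]
    {S : ι → Set X} (hS : ∀ i, MeasurableSet (S i)) {F : κ → X → X} (hF : ∀ i, Measurable (F i)) :
    ∃ t' ≤ t, @PolishSpace X t' ∧ @BorelSpace X t' m ∧ (∀ i, @IsClopen X t' (S i)) ∧
      ∃ b : Set (Set X), t = TopologicalSpace.generateFrom b ∧
        ∀ U ∈ b, @IsClopen X t' U ∧ ∀ i, @IsClopen X t' (F i ⁻¹' U) := by
  let b := TopologicalSpace.countableBasis X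
  have : Countable b := (TopologicalSpace.countable_countableBasis X).to_subtype
  have hU : ∀ U : b, MeasurableSet (U : Set X) := fun U =>
    (TopologicalSpace.isOpen_of_mem_countableBasis U.2).measurableSet
  have hgen : t = TopologicalSpace.generateFrom b :=
    (TopologicalSpace.isBasis_countableBasis X).eq_generateFrom
  obtain ⟨t', h1, h2, h3, h4⟩ := exists_polishSpace_isClopen ht hb
    (S := Sum.elim S (Sum.elim (fun U : b => (U : Set X)) fun p : b × κ => F p.2 ⁻¹' p.1)) (by
      rintro (i | U | ⟨U, i⟩)
      exacts [hS i, hU U, hF i (hU U)])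
  exact ⟨t', h1, h2, h3, fun i => h4 (Sum.inl i), b, hgen,
    fun U hU => ⟨h4 (Sum.inr (Sum.inl ⟨U, hU⟩)), fun i => h4 (Sum.inr (Sum.inr (⟨U, hU⟩, i)))⟩⟩

/-- A Polish topology can be refined to a zero-dimensional Polish topology making countably many
Borel sets clopen and countably many Borel self-maps continuous. -/
theorem exists_polishSpace_isClopen_continuous {X : Type} [m : MeasurableSpace X]
    {t : TopologicalSpace X}
    (ht : @PolishSpace X t) (hb : @BorelSpace X t m) {ι κ : Type} [Countable ι] [Countable κ]
    {S : ι → Set X} (hS : ∀ i, MeasurableSet (S i)) {F : κ → X → X} (hF : ∀ i, Measurable (F i)) :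
    ∃ t' ≤ t, @PolishSpace X t' ∧ @BorelSpace X t' m ∧ (∀ i, @IsClopen X t' (S i)) ∧
      @TopologicalSpace.IsTopologicalBasis X t' {s | @IsClopen X t' s} ∧
      ∀ i, @Continuous X X t' t' (F i) := by
  choose next hle hpol hbor hclo b hbas hbclo using fun (t : TopologicalSpace X)
    (ht : @PolishSpace X t) (hb : @BorelSpace X t m) =>
      exists_polishSpace_isClopen_preimage ht hb hS hF
  let T := {t : TopologicalSpace X // @PolishSpace X t ∧ @BorelSpace X t m}
  let seq : ℕ → T := fun n => Nat.rec ⟨t, ht, hb⟩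
    (fun _ s => ⟨next s.1 s.2.1 s.2.2, hpol s.1 s.2.1 s.2.2, hbor s.1 s.2.1 s.2.2⟩) n
  have hmono : ∀ n, (seq n).1 ≤ t := by
    intro n
    induction n with
    | zero => exact le_rfl
    | succ n ih => exact (hle (seq n).1 (seq n).2.1 (seq n).2.2).trans ih
  let t' : TopologicalSpace X := ⨅ n, (seq n).1
  have ht'n : ∀ n, t' ≤ (seq n).1 := iInf_le _
  have ht' : @PolishSpace X t' := PolishSpace.iInf ⟨0, hmono⟩ fun n => (seq n).2.1
  have hclopen : ∀ n s, @IsClopen X (seq n).1 s → @IsClopen X t' s := fun n s hs =>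
    ⟨hs.1.mono (ht'n n), ht'n n _ hs.2⟩
  refine ⟨t', ht'n 0, ht', ⟨?_⟩, fun i => hclopen 1 _ (hclo t ht hb i), ?_, fun i => ?_⟩
  · rw [hb.measurable_eq, borel_eq_borel_of_le ht' ht (ht'n 0)]
  · have hgen : t' = TopologicalSpace.generateFrom {s | @IsClopen X t' s} := by
      refine le_antisymm (le_generateFrom fun s hs => hs.2) (le_iInf fun n => ?_)
      refine (TopologicalSpace.generateFrom_anti fun U hU => ?_).trans
        (hbas (seq n).1 (seq n).2.1 (seq n).2.2).ge
      exact hclopen (n + 1) _ (hbclo (seq n).1 (seq n).2.1 (seq n).2.2 U hU).1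
    convert TopologicalSpace.isTopologicalBasis_of_subbasis hgen using 1
    ext s
    constructor
    · exact fun hs => ⟨{s}, ⟨finite_singleton s, singleton_subset_iff.2 hs⟩, sInter_singleton s⟩
    · rintro ⟨𝒜, ⟨hfin, h𝒜⟩, rfl⟩
      exact ⟨isClosed_sInter fun s hs => (h𝒜 hs).1, hfin.isOpen_sInter fun s hs => (h𝒜 hs).2⟩
  · refine continuous_iInf_rng.2 fun n => ?_
    rw [hbas (seq n).1 (seq n).2.1 (seq n).2.2]
    refine continuous_generateFrom_iff.2 fun U hU => ?_
    exact (hclopen (n + 1) _ ((hbclo (seq n).1 (seq n).2.1 (seq n).2.2 U hU).2 i)).2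

theorem subF_val {X : Type} {B : Set X} {f : X → X} {x : B} (h : f x ∈ B) :
    (subF B f x : X) = f x := by
  simp [subF, h]

theorem mem_restrGraphs {X : Type} {B : Set X} {D : ℕ → Set X} {f : ℕ → X → X} {p : B × B} :
    p ∈ restrGraphs B D f ↔ ((p.1 : X), (p.2 : X)) ∈ unionGraphs D f := by
  simp only [restrGraphs, unionGraphs, mem_iUnion]
  refine exists_congr fun n => ⟨fun h => ⟨h.1.1, ?_⟩, fun h => ?_⟩
  · rw [h.2, subF_val h.1.2]
  · have hB : f n p.1 ∈ B := by
      have := h.2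
      simp only at this
      rw [← this]
      exact p.2.2
    exact ⟨⟨h.1, hB⟩, Subtype.ext (by rw [subF_val hB]; exact h.2)⟩

theorem IsPartialHomeo.isOpen_image {X : Type} [t : TopologicalSpace X] {D : Set X} {f : X → X}
    (h : IsPartialHomeo t D f) {U : Set X} (hU : IsOpen U) (hUD : U ⊆ D) : IsOpen (f '' U) := by
  obtain ⟨-, hD', -, g, hg, hgf⟩ := h
  have : f '' U = f '' D ∩ g ⁻¹' U := by
    ext y
    constructor
    · rintro ⟨x, hx, rfl⟩
      exact ⟨⟨x, hUD hx, rfl⟩, by rwa [mem_preimage, hgf x (hUD hx)]⟩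
    · rintro ⟨⟨x, hx, rfl⟩, hxU⟩
      rw [mem_preimage, hgf x hx] at hxU
      exact ⟨x, hxU, rfl⟩
  rw [this]
  exact hg.isOpen_inter_preimage hD'.2 hU

/-- A partial homeomorphism restricts to an invariant subset. -/
theorem IsPartialHomeo.subtype {X : Type} [t : TopologicalSpace X] {D D' B : Set X} {f : X → X}
    (h : IsPartialHomeo t D f) (hB : ∀ x ∈ D, (x ∈ B ↔ f x ∈ B))
    (hD : subD B D' f = Subtype.val ⁻¹' D) :
    IsPartialHomeo (subTop t B) (subD B D' f) (subF B f) := by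
  obtain ⟨hDc, hD', hf, g, hg, hgf⟩ := h
  have hmem : ∀ x ∈ subD B D' f, f x ∈ B ∧ (subF B f x : X) = f x := fun x hx =>
    ⟨hx.2, subF_val hx.2⟩
  have himg : subF B f '' subD B D' f = Subtype.val ⁻¹' (f '' D) := by
    ext y
    constructor
    · rintro ⟨x, hx, rfl⟩
      rw [mem_preimage, (hmem x hx).2]
      rw [hD] at hx
      exact ⟨x, hx, rfl⟩
    · rintro ⟨x, hx, hxy⟩
      have hxB : x ∈ B := (hB x hx).2 (by rw [hxy]; exact y.2)
      have hxD : (⟨x, hxB⟩ : B) ∈ subD B D' f := by rw [hD]; exact hx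
      exact ⟨⟨x, hxB⟩, hxD, Subtype.ext ((hmem _ hxD).2.trans hxy)⟩
  have hgmem : ∀ y ∈ (Subtype.val ⁻¹' (f '' D) : Set B), g y ∈ B := by
    rintro y ⟨x, hx, hxy⟩
    rw [← hxy, hgf x hx, hB x hx, hxy]
    exact y.2
  refine ⟨?_, ?_, ?_, subF B g, ?_, ?_⟩
  · rw [hD]
    exact hDc.preimage continuous_subtype_val
  · rw [himg]
    exact hD'.preimage continuous_subtype_val
  · refine IsInducing.subtypeVal.continuousOn_iff.2 ?_
    refine ContinuousOn.congr ?_ fun x hx => (hmem x hx).2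
    rw [hD]
    exact hf.comp continuous_subtype_val.continuousOn fun x hx => hx
  · rw [himg]
    refine IsInducing.subtypeVal.continuousOn_iff.2 ?_
    refine ContinuousOn.congr ?_ fun y hy => subF_val (hgmem y hy)
    exact hg.comp continuous_subtype_val.continuousOn fun x hx => hx
  · intro x hx
    have hxD : (x : X) ∈ D := by rw [hD] at hx; exact hx
    have hgx : g (subF B f x) = x := by rw [(hmem x hx).2, hgf x hxD]
    exact Subtype.ext ((subF_val (by rw [hgx]; exact x.2)).trans hgx)

theorem exists_polishSpace_nonsingular {Z X : Type} [TopologicalSpace Z]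
    [SecondCountableTopology Z] [BaireSpace Z] [MeasurableSpace Z] [BorelSpace Z]
    [t : TopologicalSpace X] [ht : PolishSpace X] [m : MeasurableSpace X] [hb : BorelSpace X]
    {h : Z → X} (hh : Measurable h) {D : ℕ → Set X} {f : ℕ → X → X}
    (hpart : ∀ n, IsPartialHomeo t (D n) (f n)) {B₀ : Set X} (hB₀ : MeasurableSet B₀)
    (hB₀h : ∀ z, h z ∈ B₀) {ι : Type} [Countable ι] {S : ι → Set X}
    (hS : ∀ i, MeasurableSet (S i)) :
    ∃ t' ≤ t, @PolishSpace X t' ∧ @BorelSpace X t' m ∧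
      @TopologicalSpace.IsTopologicalBasis X t' {s | @IsClopen X t' s} ∧
      (∀ i, @IsClopen X t' (S i)) ∧
      ∃ B ⊆ B₀, @IsClopen X t' B ∧ IsMeagre (h ⁻¹' Bᶜ) ∧ ∀ n,
        IsPartialHomeo t' {x | x ∈ D n ∧ x ∈ B ∧ f n x ∈ B} (f n) ∧
        ∀ C ⊆ {x | x ∈ D n ∧ x ∈ B ∧ f n x ∈ B}, MeasurableSet C →
          (IsMeagre (h ⁻¹' C) ↔ IsMeagre (h ⁻¹' (f n '' C))) := by
  choose hDc hDc' hf g hg hgf using hpart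
  have hinj : ∀ n, InjOn (f n) (D n) := fun n => LeftInvOn.injOn (f₁' := g n) (hgf n)
  choose N hN hNh hNC using fun n => exists_isMeagre_nonsingular hh (hf n) (hinj n)
  let B : Set X := B₀ \ ⋃ n, N n
  have hB : MeasurableSet B := hB₀.diff (MeasurableSet.iUnion hN)
  classical
  let F : ℕ → X → X := fun n => (D n).piecewise (f n) id
  let G : ℕ → X → X := fun n => (f n '' D n).piecewise (g n) id
  have hF : ∀ n, Measurable (F n) := fun n =>
    (hf n).measurable_piecewise continuousOn_id (hDc n).1.measurableSet
  have hG : ∀ n, Measurable (G n) := fun n =>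
    (hg n).measurable_piecewise continuousOn_id (hDc' n).1.measurableSet
  let R : ℕ → Set X := fun n => {x | x ∈ D n ∧ x ∈ B ∧ f n x ∈ B}
  have hRD : ∀ n, R n ⊆ D n := fun n x hx => hx.1
  have hR : ∀ n, MeasurableSet (R n) := fun n => by
    have : R n = D n ∩ (B ∩ F n ⁻¹' B) := by
      ext x
      refine and_congr_right fun hx => ?_
      simp [F, hx]
    rw [this]
    exact (hDc n).1.measurableSet.inter (hB.inter (hF n hB))
  have hR' : ∀ n, MeasurableSet (f n '' R n) := fun n =>
    (hR n).image_of_continuousOn_injOn ((hf n).mono (hRD n)) ((hinj n).mono (hRD n))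
  obtain ⟨t', ht't, ht', hb', hclo, hbas, hcont⟩ := exists_polishSpace_isClopen_continuous ht hb
    (S := Sum.elim S (Sum.elim (fun _ : Unit => B) (Sum.elim R fun n => f n '' R n)))
    (F := Sum.elim F G)
    (by rintro (i | _ | n | n); exacts [hS i, hB, hR n, hR' n])
    (by rintro (n | n); exacts [hF n, hG n])
  refine ⟨t', ht't, ht', hb', hbas, fun i => hclo (Sum.inl i), B, sdiff_subset,
    hclo (Sum.inr (Sum.inl ())), ?_, fun n => ⟨⟨hclo (Sum.inr (Sum.inr (Sum.inl n))),
      hclo (Sum.inr (Sum.inr (Sum.inr n))), ?_, G n, (hcont (Sum.inr n)).continuousOn, ?_⟩, ?_⟩⟩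
  · refine (isMeagre_iUnion hNh).mono fun z hz => ?_
    by_contra hzN
    exact hz ⟨hB₀h z, fun hz' => hzN (by simpa using hz')⟩
  · refine @ContinuousOn.congr X X t' t' _ _ _ (hcont (Sum.inl n)).continuousOn fun x hx => ?_
    simp [F, hx.1]
  · intro x hx
    have : f n x ∈ f n '' D n := ⟨x, hx.1, rfl⟩
    rw [show G n (f n x) = g n (f n x) from piecewise_eq_of_mem _ _ _ this, hgf n x hx.1]
  · intro C hC hCm
    refine hNC n C (hC.trans (hRD n)) hCm ?_ ?_
    · exact disjoint_left.2 fun x hx hxN => (hC hx).2.1.2 (mem_iUnion_of_mem n hxN)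
    · refine disjoint_left.2 ?_
      rintro _ ⟨x, hx, rfl⟩ hxN
      exact (hC hx).2.2.2 (mem_iUnion_of_mem n hxN)

theorem exists_isClosed_convSit {Z X : Type} [TopologicalSpace Z] [BaireSpace Z] [Nonempty Z]
    (t : TopologicalSpace X) [t' : TopologicalSpace X] [ht' : PolishSpace X] [MeasurableSpace X]
    [BorelSpace X] (hle : t' ≤ t)
    (hbas : TopologicalSpace.IsTopologicalBasis {s : Set X | IsClopen s})
    {D : ℕ → Set X} {f : ℕ → X → X}
    (hdiag : diagonal X =
      @closure (X × X) (@instTopologicalSpaceProd X X t t) (unionGraphs D f) \ unionGraphs D f)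
    {h : Z → X}
    (hedge : ∀ C : Set X, MeasurableSet C → ¬ IsMeagre (h ⁻¹' C) →
      ∃ x ∈ C, ∃ y ∈ C, (x, y) ∈ unionGraphs D f)
    {B₁ : Set X} (hB₁ : IsClopen B₁) (hB₁h : IsMeagre (h ⁻¹' B₁ᶜ))
    (hpart : ∀ n, IsPartialHomeo t' {x | x ∈ D n ∧ x ∈ B₁ ∧ f n x ∈ B₁} (f n))
    (hns : ∀ n, ∀ C ⊆ {x | x ∈ D n ∧ x ∈ B₁ ∧ f n x ∈ B₁}, MeasurableSet C →
      (IsMeagre (h ⁻¹' C) ↔ IsMeagre (h ⁻¹' (f n '' C)))) :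
    ∃ B ⊆ B₁, IsClosed B ∧
      ConvSit ↥B (subTop t' B) (fun n => subD B (D n) (f n)) (fun n => subF B (f n)) := by
  let 𝒲 : Set (Set X) := {U | IsOpen U ∧ IsMeagre (h ⁻¹' U)}
  have hW : IsOpen (⋃₀ 𝒲) := isOpen_sUnion fun U hU => hU.1
  have hWh : IsMeagre (h ⁻¹' ⋃₀ 𝒲) := by
    obtain ⟨T, hT, hTW, hTeq⟩ := TopologicalSpace.isOpen_sUnion_countable 𝒲 fun U hU => hU.1
    have := hT.to_subtype
    rw [← hTeq, sUnion_eq_iUnion, preimage_iUnion]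
    exact isMeagre_iUnion fun U : T => (hTW U.2).2
  let B : Set X := (⋃₀ 𝒲)ᶜ
  have hBcl : IsClosed B := hW.isClosed_compl
  have hBB₁ : B ⊆ B₁ := fun x hx => by
    by_contra hx1
    exact hx ⟨B₁ᶜ, ⟨hB₁.1.isOpen_compl, hB₁h⟩, hx1⟩
  have hBne : B.Nonempty := by
    rw [nonempty_iff_ne_empty]
    intro hBe
    refine not_isMeagre_of_isOpen (X := Z) isOpen_univ univ_nonempty (hWh.mono fun z _ => ?_)
    by_contra hz
    exact (hBe ▸ (show h z ∈ B from hz) : h z ∈ (∅ : Set X))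
  have hBedge : ∀ U : Set X, IsOpen U → (U ∩ B).Nonempty →
      ∃ x ∈ U ∩ B, ∃ y ∈ U ∩ B, (x, y) ∈ unionGraphs D f := by
    rintro U hU ⟨x, hxU, hxB⟩
    refine hedge _ (hU.measurableSet.inter hBcl.measurableSet) fun hm => hxB ⟨U, ⟨hU, ?_⟩, hxU⟩
    refine (hm.union hWh).mono fun z hz => ?_
    by_cases hzW : h z ∈ ⋃₀ 𝒲
    · exact Or.inr hzW
    · exact Or.inl ⟨hz, hzW⟩
  have hinv : ∀ n, ∀ x ∈ {x | x ∈ D n ∧ x ∈ B₁ ∧ f n x ∈ B₁}, (x ∈ B ↔ f n x ∈ B) := by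
    intro n x hx
    refine not_congr ⟨?_, ?_⟩
    · rintro ⟨U, ⟨hU, hUh⟩, hxU⟩
      have hV : IsOpen (U ∩ {x | x ∈ D n ∧ x ∈ B₁ ∧ f n x ∈ B₁}) := hU.inter (hpart n).1.2
      refine ⟨f n '' (U ∩ {x | x ∈ D n ∧ x ∈ B₁ ∧ f n x ∈ B₁}),
        ⟨(hpart n).isOpen_image hV inter_subset_right, ?_⟩, x, ⟨hxU, hx⟩, rfl⟩
      exact (hns n _ inter_subset_right hV.measurableSet).1
        (hUh.mono (preimage_mono inter_subset_left))
    · rintro ⟨U, ⟨hU, hUh⟩, hxU⟩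
      have hV : IsOpen ({x | x ∈ D n ∧ x ∈ B₁ ∧ f n x ∈ B₁} ∩ f n ⁻¹' U) :=
        (hpart n).2.2.1.isOpen_inter_preimage (hpart n).1.2 hU
      refine ⟨_, ⟨hV, ?_⟩, ⟨hx, hxU⟩⟩
      refine (hns n _ inter_subset_left hV.measurableSet).2 (hUh.mono (preimage_mono ?_))
      rintro _ ⟨x, hx, rfl⟩
      exact hx.2
  have hirr : ∀ x, (x, x) ∉ unionGraphs D f := fun x hx => by
    have : (x, x) ∈ diagonal X := rfl
    rw [hdiag] at this
    exact this.2 hx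
  have hpolB : PolishSpace B := hBcl.polishSpace
  refine ⟨B, hBB₁, hBcl, hBne.to_subtype, hpolB, ?_, ⟨isClosed_univ, fun x _ => ?_⟩,
    fun n => (hpart n).subtype (hinv n) ?_, Subset.antisymm ?_ ?_⟩
  · refine TopologicalSpace.isTopologicalBasis_of_isOpen_of_nhds (fun s hs => hs.2) ?_
    rintro x U hxU ⟨V, hV, rfl⟩
    obtain ⟨s, hs, hxs, hsV⟩ := hbas.exists_subset_of_mem_open hxU hV
    exact ⟨Subtype.val ⁻¹' s, IsClopen.preimage hs continuous_subtype_val, hxs,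
      preimage_mono hsV⟩
  · rw [accPt_iff_nhds]
    intro U hU
    obtain ⟨V, hV, hVU⟩ := mem_nhds_induced _ _ _ |>.1 hU
    obtain ⟨V', hV'V, hV', hxV'⟩ := mem_nhds_iff.1 hV
    obtain ⟨a, ⟨ha, haB⟩, c, ⟨hc, hcB⟩, hac⟩ := hBedge V' hV' ⟨x, hxV', x.2⟩
    by_cases hax : a = x
    · refine ⟨⟨c, hcB⟩, ⟨hVU (hV'V hc), mem_univ _⟩, fun hcx => hirr a ?_⟩
      have hcx' : c = x := congrArg Subtype.val hcx
      rwa [hcx', ← hax] at hac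
    · exact ⟨⟨a, haB⟩, ⟨hVU (hV'V ha), mem_univ _⟩, fun hax' => hax (congrArg Subtype.val hax')⟩
  · ext x
    exact ⟨fun hx => ⟨hx.1, hBB₁ x.2, hBB₁ hx.2⟩,
      fun hx => ⟨hx.1, (hinv n x hx).1 x.2⟩⟩
  · rintro ⟨x, y⟩ hxy
    obtain rfl : x = y := hxy
    refine ⟨mem_closure_iff_nhds.2 fun U hU => ?_, fun hx => hirr x (mem_restrGraphs.1 hx)⟩
    obtain ⟨U₁, hU₁, hU₁U⟩ := (nhds_prod_eq (x := x) (y := x) ▸ hU : U ∈ 𝓝 x ×ˢ 𝓝 x) |>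
      Filter.mem_prod_same_iff.1
    obtain ⟨V, hV, hVU⟩ := mem_nhds_induced _ _ _ |>.1 hU₁
    obtain ⟨V', hV'V, hV', hxV'⟩ := mem_nhds_iff.1 hV
    obtain ⟨a, ⟨ha, haB⟩, c, ⟨hc, hcB⟩, hac⟩ := hBedge V' hV' ⟨x, hxV', x.2⟩
    exact ⟨(⟨a, haB⟩, ⟨c, hcB⟩), hU₁U ⟨hVU (hV'V ha), hVU (hV'V hc)⟩, mem_restrGraphs.2 hac⟩
  · rintro ⟨x, y⟩ ⟨hxy, hxy'⟩
    have hcont : @Continuous (B × B) (X × X) _ (@instTopologicalSpaceProd X X t t)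
        (fun p => ((p.1 : X), (p.2 : X))) :=
      @Continuous.prodMk X X (B × B) t t _ _ _
        (continuous_le_rng hle (continuous_subtype_val.comp continuous_fst))
        (continuous_le_rng hle (continuous_subtype_val.comp continuous_snd))
    have hcl := @map_mem_closure (B × B) (X × X) _ (@instTopologicalSpaceProd X X t t) _
      (restrGraphs B D f) _ (unionGraphs D f) hcont hxy fun p hp => mem_restrGraphs.1 hp
    have : ((x : X), (y : X)) ∈ diagonal X := by
      rw [hdiag]
      exact ⟨hcl, fun hxy'' => hxy' (mem_restrGraphs.2 hxy'')⟩
    exact Subtype.ext this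

theorem exists_convSit_of_not_potClosed {X Y Y' : Type} [t : TopologicalSpace X]
    [tY : TopologicalSpace Y] [tY' : TopologicalSpace Y'] [PolishSpace Y] [PolishSpace Y']
    {D : ℕ → Set X} {f : ℕ → X → X} (hconv : ConvSit X t D f) {u : Y → X} {v : Y' → X}
    (hu : Continuous u) (hv : Continuous v)
    (hA : ¬ PotClosed tY tY' ((fun p : Y × Y' => (u p.1, v p.2)) ⁻¹' unionGraphs D f)) :
    ∃ (B : Set X) (τ : TopologicalSpace ↥B),
      @MeasurableSet X (@borel X t) B ∧ τ ≤ subTop t B ∧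
      ConvSit ↥B τ (fun n => subD B (D n) (f n)) (fun n => subF B (f n)) ∧
      RedRC τ τ tY tY' (restrGraphs B D f)
        ((fun p : Y × Y' => (u p.1, v p.2)) ⁻¹' unionGraphs D f) := by
  obtain ⟨-, ht, -, -, hpart, hdiag⟩ := hconv
  borelize X
  let E := {p : Y × Y' // u p.1 = v p.2}
  have hE : PolishSpace E := (isClosed_eq (hu.comp continuous_fst) (hv.comp continuous_snd) :
    IsClosed {p : Y × Y' | u p.1 = v p.2}).polishSpace
  let φ : E → X := fun e => u e.1.1
  have hφ : Continuous φ := hu.comp (continuous_fst.comp continuous_subtype_val)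
  have hcov : ∀ 𝒞 : Set (Set X), 𝒞.Countable → (∀ C ∈ 𝒞, MeasurableSet C ∧ IndepSet D f C) →
      ∃ e, φ e ∉ ⋃₀ 𝒞 := by
    intro 𝒞 h𝒞 h𝒞'
    by_contra! hcon
    have := h𝒞.to_subtype
    refine hA (potClosed_of_cover hdiag hu hv (fun C : 𝒞 => (C : Set X)) (fun C => (h𝒞' C C.2).1)
      (fun C => (h𝒞' C C.2).2) fun y y' hyy' => ?_)
    obtain ⟨C, hC, hyC⟩ := hcon ⟨(y, y'), hyy'⟩
    exact ⟨⟨C, hC⟩, hyC⟩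
  obtain ⟨b, hb⟩ := exists_seq_initSeg_dense
  obtain ⟨ψ, hψ, hψE⟩ := exists_continuous_homomorphism (fun n => (hpart n).1.1)
    (fun n => (hpart n).2.2.1) hφ b hcov
  let h : Cantor → X := fun γ => φ (ψ γ)
  have hh : Continuous h := hφ.comp hψ
  obtain ⟨s₀, hs₀, hs₀h⟩ := exists_measurable_section hh
  let s : X → E := fun x => ψ (s₀ x)
  have hsφ : ∀ x ∈ range h, φ (s x) = x := by
    rintro _ ⟨γ, rfl⟩
    exact hs₀h γ
  have hedge : ∀ C : Set X, MeasurableSet C → ¬ IsMeagre (h ⁻¹' C) →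
      ∃ x ∈ C, ∃ y ∈ C, (x, y) ∈ unionGraphs D f := by
    intro C hC hCh
    obtain ⟨k, γ, h1, h2, h3, h4⟩ := exists_edge_of_not_isMeagre hb (hh.measurable hC) hCh
    exact ⟨_, h3, _, h4, hψE k γ h1 h2⟩
  let b' := TopologicalSpace.countableBasis E
  have : Countable b' := (TopologicalSpace.countable_countableBasis E).to_subtype
  have hbas' := TopologicalSpace.isBasis_countableBasis E
  obtain ⟨t', ht't, ht', hbor, hbas, hclo, B₁, hB₁, hB₁c, hB₁h, hpart'⟩ :=
    exists_polishSpace_nonsingular hh.measurable hpart (isCompact_range hh).isClosed.measurableSet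
      (fun z => mem_range_self z) (S := fun U : b' => s ⁻¹' U) fun U =>
        hs₀ ((TopologicalSpace.isOpen_of_mem_countableBasis U.2).preimage hψ).measurableSet
  have hs : @Continuous X E t' _ s := by
    rw [hbas'.eq_generateFrom]
    exact continuous_generateFrom_iff.2 fun U hU => (hclo ⟨U, hU⟩).2
  obtain ⟨B, hBB₁, hBcl, hBconv⟩ := exists_isClosed_convSit t (t' := t') ht't hbas hdiag hedge
    hB₁c hB₁h (fun n => (hpart' n).1) fun n => (hpart' n).2
  refine ⟨B, subTop t' B, hBcl.measurableSet, induced_mono ht't, hBconv, fun x => (s x).1.1, fun x => (s x).1.2,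
    ?_, ?_, ?_⟩
  · exact (continuous_fst.comp continuous_subtype_val).comp (hs.comp continuous_induced_dom)
  · exact (continuous_snd.comp continuous_subtype_val).comp (hs.comp continuous_induced_dom)
  · ext p
    have h1 : u (s p.1).1.1 = p.1 := hsφ _ (hB₁ (hBB₁ p.1.2))
    have h2 : v (s p.2).1.2 = p.2 := (s p.2).2.symm.trans (hsφ _ (hB₁ (hBB₁ p.2.2)))
    rw [mem_restrGraphs, mem_preimage, mem_preimage, h1, h2]

end

theorem stmt7 {X Y Y' : Type} (t : TopologicalSpace X)
    (tY : TopologicalSpace Y) (tY' : TopologicalSpace Y')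
    (hY : @PolishSpace Y tY) (hY' : @PolishSpace Y' tY')
    (D : ℕ → Set X) (f : ℕ → X → X) (hconv : ConvSit X t D f)
    (A : Set (Y × Y'))
    (hA : @MeasurableSet (Y × Y') (@borel (Y × Y') (@instTopologicalSpaceProd Y Y' tY tY')) A)
    (hred : RedRC tY tY' t t A (unionGraphs D f)) :
    Xor'
      (PotClosed tY tY' A)
      (∃ (B : Set X) (τ : TopologicalSpace ↥B),
        @MeasurableSet X (@borel X t) B ∧ τ ≤ subTop t B ∧
        ConvSit ↥B τ (fun n => subD B (D n) (f n)) (fun n => subF B (f n)) ∧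
        RedRC τ τ tY tY' (restrGraphs B D f) A) := by
  obtain ⟨u, v, hu, hv, rfl⟩ := hred
  by_cases hpot : PotClosed tY tY' ((fun p : Y × Y' => (u p.1, v p.2)) ⁻¹' unionGraphs D f)
  · refine Or.inl ⟨hpot, ?_⟩
    rintro ⟨B, τ, -, -, hB, hBred⟩
    exact not_redRC_of_potClosed hY hY' hB hpot hBred
  · exact Or.inr ⟨exists_convSit_of_not_potClosed hconv hu hv hpot, hpot⟩
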